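/- (Pointwise Pohozaev-type inequality for the Gauss map, Lemma 4.1.) There is a universal constant C > 0 such that the following holds. Let f : (t₁,t₂)×S¹ → ℝⁿ be any conformal immersion with conformal factor e^{2u}, and let P : (t₁,t₂)×ℝ → ℝ^{n×n} be the field of orthogonal projections onto the tangent planes, P := e^{−2u}( (∂_t f)(∂_t f)ᵀ + (∂_θ f)(∂_θ f)ᵀ ). Then at every point (t,θ) ∈ (t₁,t₂)×ℝ, | ‖∂_t P‖_F² − ‖∂_θ P‖_F² | ≤ C e^{2u} |A| |H|, where ‖·‖_F is the Frobenius norm of an n×n matrix. -/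

import Mathlib

noncomputable section

open Real MeasureTheory Set Filter
open scoped InnerProductSpace

/-- Partial derivative in the first variable. -/
def pt {F : Type*} [NormedAddCommGroup F] [NormedSpace ℝ F] (f : ℝ → ℝ → F) (t θ : ℝ) : F :=
  deriv (fun s => f s θ) t

/-- Partial derivative in the second variable. -/
def pth {F : Type*} [NormedAddCommGroup F] [NormedSpace ℝ F] (f : ℝ → ℝ → F) (t θ : ℝ) : F :=
  deriv (fun s => f t s) θ

variable {n : ℕ}

/-- Mean curvature vector `H = e^{-2u}(∂_t² f + ∂_θ² f)`. -/
def Hmc (f : ℝ → ℝ → EuclideanSpace ℝ (Fin n)) (u : ℝ → ℝ → ℝ) :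
    ℝ → ℝ → EuclideanSpace ℝ (Fin n) :=
  fun t θ => Real.exp (-(2 * u t θ)) • (pt (pt f) t θ + pth (pth f) t θ)

/-- Component `A_tt` of the second fundamental form. -/
def Att (f : ℝ → ℝ → EuclideanSpace ℝ (Fin n)) (u : ℝ → ℝ → ℝ) :
    ℝ → ℝ → EuclideanSpace ℝ (Fin n) :=
  fun t θ => pt (pt f) t θ - pt u t θ • pt f t θ + pth u t θ • pth f t θ

/-- Component `A_tθ` of the second fundamental form. -/
def Atth (f : ℝ → ℝ → EuclideanSpace ℝ (Fin n)) (u : ℝ → ℝ → ℝ) :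
    ℝ → ℝ → EuclideanSpace ℝ (Fin n) :=
  fun t θ => pt (pth f) t θ - pth u t θ • pt f t θ - pt u t θ • pth f t θ

/-- Component `A_θθ` of the second fundamental form. -/
def Athth (f : ℝ → ℝ → EuclideanSpace ℝ (Fin n)) (u : ℝ → ℝ → ℝ) :
    ℝ → ℝ → EuclideanSpace ℝ (Fin n) :=
  fun t θ => pth (pth f) t θ + pt u t θ • pt f t θ - pth u t θ • pth f t θ

/-- `|A|²`, the squared norm of the second fundamental form. -/
def Asq (f : ℝ → ℝ → EuclideanSpace ℝ (Fin n)) (u : ℝ → ℝ → ℝ) : ℝ → ℝ → ℝ :=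
  fun t θ => Real.exp (-(4 * u t θ)) *
    (‖Att f u t θ‖ ^ 2 + 2 * ‖Atth f u t θ‖ ^ 2 + ‖Athth f u t θ‖ ^ 2)

/-- The left-hand side of the Willmore equation in conformal coordinates. -/
def willmoreOp (f : ℝ → ℝ → EuclideanSpace ℝ (Fin n)) (u : ℝ → ℝ → ℝ) :
    ℝ → ℝ → EuclideanSpace ℝ (Fin n) :=
  fun t θ =>
    (2 : ℝ) • (pt (pt (Hmc f u)) t θ + pth (pth (Hmc f u)) t θ)
    + (4 : ℝ) • pt (fun a b => Real.exp (-(2 * u a b)) •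
        (⟪Hmc f u a b, Att f u a b⟫_ℝ • pt f a b + ⟪Hmc f u a b, Atth f u a b⟫_ℝ • pth f a b)) t θ
    + (4 : ℝ) • pth (fun a b => Real.exp (-(2 * u a b)) •
        (⟪Hmc f u a b, Atth f u a b⟫_ℝ • pt f a b + ⟪Hmc f u a b, Athth f u a b⟫_ℝ • pth f a b)) t θ
    - pt (fun a b => ‖Hmc f u a b‖ ^ 2 • pt f a b) t θ
    - pth (fun a b => ‖Hmc f u a b‖ ^ 2 • pth f a b) t θ

/-- A conformal immersion of a cylinder `s × S¹` (in the `t` variable),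
with conformal factor `e^{2u}`; maps are `2π`-periodic in the second variable. -/
structure ConfImm (f : ℝ → ℝ → EuclideanSpace ℝ (Fin n)) (u : ℝ → ℝ → ℝ) (s : Set ℝ) :
    Prop where
  smooth_f : ContDiff ℝ (⊤ : ℕ∞) (fun p : ℝ × ℝ => f p.1 p.2)
  smooth_u : ContDiff ℝ (⊤ : ℕ∞) (fun p : ℝ × ℝ => u p.1 p.2)
  periodic_f : ∀ t θ, f t (θ + 2 * π) = f t θ
  periodic_u : ∀ t θ, u t (θ + 2 * π) = u t θ
  conf_t : ∀ t ∈ s, ∀ θ : ℝ, ‖pt f t θ‖ ^ 2 = Real.exp (2 * u t θ)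
  conf_th : ∀ t ∈ s, ∀ θ : ℝ, ‖pth f t θ‖ ^ 2 = Real.exp (2 * u t θ)
  conf_orth : ∀ t ∈ s, ∀ θ : ℝ, ⟪pt f t θ, pth f t θ⟫_ℝ = 0

/-- A conformal Willmore immersion of a cylinder. -/
structure ConfWillmore (f : ℝ → ℝ → EuclideanSpace ℝ (Fin n)) (u : ℝ → ℝ → ℝ) (s : Set ℝ)
    extends ConfImm f u s : Prop where
  willmore : ∀ t ∈ s, ∀ θ : ℝ, willmoreOp f u t θ = 0

/-- The first residue `τ₁(f,c)(t)`. -/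
def tau1 (f : ℝ → ℝ → EuclideanSpace ℝ (Fin n)) (u : ℝ → ℝ → ℝ)
    (c : EuclideanSpace ℝ (Fin n)) (t : ℝ) : ℝ :=
  ⟪(-2 : ℝ) • (∫ θ in (0 : ℝ)..(2 * π), pt (Hmc f u) t θ)
    - (4 : ℝ) • (∫ θ in (0 : ℝ)..(2 * π), Real.exp (-(2 * u t θ)) •
        (⟪Hmc f u t θ, Att f u t θ⟫_ℝ • pt f t θ + ⟪Hmc f u t θ, Atth f u t θ⟫_ℝ • pth f t θ))
    + ∫ θ in (0 : ℝ)..(2 * π), ‖Hmc f u t θ‖ ^ 2 • pt f t θ, c⟫_ℝ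

/-- The second residue `τ₂(f,S)(t)`, for a matrix `S`. -/
def tau2 (f : ℝ → ℝ → EuclideanSpace ℝ (Fin n)) (u : ℝ → ℝ → ℝ)
    (S : Matrix (Fin n) (Fin n) ℝ) (t : ℝ) : ℝ :=
  2 * (∫ θ in (0 : ℝ)..(2 * π),
        (⟪Hmc f u t θ, pt (fun a b => (Matrix.toEuclideanLin S) (f a b)) t θ⟫_ℝ
          - ⟪pt (Hmc f u) t θ, (Matrix.toEuclideanLin S) (f t θ)⟫_ℝ))
  - 4 * (∫ θ in (0 : ℝ)..(2 * π), Real.exp (-(2 * u t θ)) *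
        (⟪Hmc f u t θ, Att f u t θ⟫_ℝ * ⟪pt f t θ, (Matrix.toEuclideanLin S) (f t θ)⟫_ℝ
          + ⟪Hmc f u t θ, Atth f u t θ⟫_ℝ * ⟪pth f t θ, (Matrix.toEuclideanLin S) (f t θ)⟫_ℝ))
  + ∫ θ in (0 : ℝ)..(2 * π), ‖Hmc f u t θ‖ ^ 2 * ⟪pt f t θ, (Matrix.toEuclideanLin S) (f t θ)⟫_ℝ

/-- Pointwise norm of the gradient of a scalar function on the cylinder. -/
def gradNorm (u : ℝ → ℝ → ℝ) (t θ : ℝ) : ℝ :=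
  Real.sqrt ((pt u t θ) ^ 2 + (pth u t θ) ^ 2)

/-- Integral of a density over the piece `[a,b] × S¹` of the cylinder. -/
def cylInt (F : ℝ → ℝ → ℝ) (a b : ℝ) : ℝ :=
  ∫ p in Set.Icc a b ×ˢ Set.Icc (0 : ℝ) (2 * π), F p.1 p.2

/-- The density `|A|² dV_g` (with respect to `dt dθ`). -/
def Adens (f : ℝ → ℝ → EuclideanSpace ℝ (Fin n)) (u : ℝ → ℝ → ℝ) : ℝ → ℝ → ℝ :=
  fun t θ => Asq f u t θ * Real.exp (2 * u t θ)

/-- The density `|H|² dV_g` (with respect to `dt dθ`). -/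
def Hdens (f : ℝ → ℝ → EuclideanSpace ℝ (Fin n)) (u : ℝ → ℝ → ℝ) : ℝ → ℝ → ℝ :=
  fun t θ => ‖Hmc f u t θ‖ ^ 2 * Real.exp (2 * u t θ)

/-- The field of orthogonal projections onto the tangent planes,
`P = e^{-2u}((∂_t f)(∂_t f)ᵀ + (∂_θ f)(∂_θ f)ᵀ)`, given entrywise. -/
def Pproj (f : ℝ → ℝ → EuclideanSpace ℝ (Fin n)) (u : ℝ → ℝ → ℝ) (t θ : ℝ) (i j : Fin n) : ℝ :=
  Real.exp (-(2 * u t θ)) * (pt f t θ i * pt f t θ j + pth f t θ i * pth f t θ j)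

section PartialDerivatives

variable {F : Type*} [NormedAddCommGroup F] [NormedSpace ℝ F] {g : ℝ → ℝ → F}

theorem hasDerivAt_fderiv_fst (hg : ContDiff ℝ (⊤ : ℕ∞) (fun p : ℝ × ℝ => g p.1 p.2)) (t θ : ℝ) :
    HasDerivAt (fun s => g s θ) (fderiv ℝ (fun p : ℝ × ℝ => g p.1 p.2) (t, θ) (1, 0)) t := by
  have h1 := (hg.differentiable (by simp) (t, θ)).hasFDerivAt
  have h2 : HasDerivAt (fun s : ℝ => (s, θ)) ((1 : ℝ), (0 : ℝ)) t :=
    (hasDerivAt_id t).prodMk (hasDerivAt_const t θ)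
  exact h1.comp_hasDerivAt t h2

theorem hasDerivAt_fderiv_snd (hg : ContDiff ℝ (⊤ : ℕ∞) (fun p : ℝ × ℝ => g p.1 p.2)) (t θ : ℝ) :
    HasDerivAt (fun s => g t s) (fderiv ℝ (fun p : ℝ × ℝ => g p.1 p.2) (t, θ) (0, 1)) θ := by
  have h1 := (hg.differentiable (by simp) (t, θ)).hasFDerivAt
  have h2 : HasDerivAt (fun s : ℝ => (t, s)) ((0 : ℝ), (1 : ℝ)) θ :=
    (hasDerivAt_const θ t).prodMk (hasDerivAt_id θ)
  exact h1.comp_hasDerivAt θ h2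

theorem pt_eq_fderiv (hg : ContDiff ℝ (⊤ : ℕ∞) (fun p : ℝ × ℝ => g p.1 p.2)) (t θ : ℝ) :
    pt g t θ = fderiv ℝ (fun p : ℝ × ℝ => g p.1 p.2) (t, θ) (1, 0) :=
  (hasDerivAt_fderiv_fst hg t θ).deriv

theorem pth_eq_fderiv (hg : ContDiff ℝ (⊤ : ℕ∞) (fun p : ℝ × ℝ => g p.1 p.2)) (t θ : ℝ) :
    pth g t θ = fderiv ℝ (fun p : ℝ × ℝ => g p.1 p.2) (t, θ) (0, 1) :=
  (hasDerivAt_fderiv_snd hg t θ).deriv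

theorem hasDerivAt_pt (hg : ContDiff ℝ (⊤ : ℕ∞) (fun p : ℝ × ℝ => g p.1 p.2)) (t θ : ℝ) :
    HasDerivAt (fun s => g s θ) (pt g t θ) t :=
  (hasDerivAt_fderiv_fst hg t θ).differentiableAt.hasDerivAt

theorem hasDerivAt_pth (hg : ContDiff ℝ (⊤ : ℕ∞) (fun p : ℝ × ℝ => g p.1 p.2)) (t θ : ℝ) :
    HasDerivAt (fun s => g t s) (pth g t θ) θ :=
  (hasDerivAt_fderiv_snd hg t θ).differentiableAt.hasDerivAt

theorem contDiff_pt (hg : ContDiff ℝ (⊤ : ℕ∞) (fun p : ℝ × ℝ => g p.1 p.2)) :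
    ContDiff ℝ (⊤ : ℕ∞) (fun p : ℝ × ℝ => pt g p.1 p.2) := by
  simp only [pt_eq_fderiv hg]
  exact (hg.fderiv_right (by simp)).clm_apply contDiff_const

theorem contDiff_pth (hg : ContDiff ℝ (⊤ : ℕ∞) (fun p : ℝ × ℝ => g p.1 p.2)) :
    ContDiff ℝ (⊤ : ℕ∞) (fun p : ℝ × ℝ => pth g p.1 p.2) := by
  simp only [pth_eq_fderiv hg]
  exact (hg.fderiv_right (by simp)).clm_apply contDiff_const

/-- Mixed partial derivatives of a smooth map commute. -/
theorem pth_pt_eq_pt_pth (hg : ContDiff ℝ (⊤ : ℕ∞) (fun p : ℝ × ℝ => g p.1 p.2)) (t θ : ℝ) :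
    pth (pt g) t θ = pt (pth g) t θ := by
  have hd : DifferentiableAt ℝ (fderiv ℝ (fun p : ℝ × ℝ => g p.1 p.2)) (t, θ) :=
    (hg.fderiv_right (m := (⊤ : ℕ∞)) (by simp)).differentiable (by simp) _
  have hsymm : IsSymmSndFDerivAt ℝ (fun p : ℝ × ℝ => g p.1 p.2) (t, θ) :=
    hg.contDiffAt.isSymmSndFDerivAt (by
      rw [minSmoothness_of_isRCLikeNormedField]
      exact WithTop.coe_le_coe.2 le_top)
  rw [pth_eq_fderiv (contDiff_pt hg), pt_eq_fderiv (contDiff_pth hg)]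
  simp only [pt_eq_fderiv hg, pth_eq_fderiv hg, Prod.mk.eta]
  rw [fderiv_clm_apply hd (differentiableAt_const _), fderiv_clm_apply hd (differentiableAt_const _)]
  simpa using hsymm (0, 1) (1, 0)

end PartialDerivatives

section ConformalFrames

variable {E : Type*} [NormedAddCommGroup E] [InnerProductSpace ℝ E]

theorem inner_deriv_self_of_norm_sq_eq_exp {X : ℝ → E} {v : ℝ → ℝ} {X' : E} {v' s : ℝ}
    (hX : HasDerivAt X X' s) (hv : HasDerivAt v v' s)
    (h : ∀ᶠ r in nhds s, ‖X r‖ ^ 2 = Real.exp (2 * v r)) :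
    ⟪X s, X'⟫_ℝ = v' * Real.exp (2 * v s) := by
  have h1 := (hv.const_mul 2).exp.congr_of_eventuallyEq h
  have := hX.norm_sq.unique h1
  linarith

theorem inner_deriv_add_inner_deriv_of_orthogonal {X Y : ℝ → E} {X' Y' : E} {s : ℝ}
    (hX : HasDerivAt X X' s) (hY : HasDerivAt Y Y' s)
    (h : ∀ᶠ r in nhds s, ⟪X r, Y r⟫_ℝ = 0) :
    ⟪X s, Y'⟫_ℝ + ⟪Y s, X'⟫_ℝ = 0 := by
  rw [real_inner_comm X' (Y s)]
  exact (hX.inner ℝ hY).unique ((hasDerivAt_const s (0 : ℝ)).congr_of_eventuallyEq h)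

/-- Derivative of the projection onto the span of a conformal frame `X, Y`, in terms of the
components `a, b` of the derivatives of the frame. -/
theorem hasDerivAt_frame_projection {X Y : ℝ → EuclideanSpace ℝ (Fin n)} {v : ℝ → ℝ}
    {X' Y' a b : EuclideanSpace ℝ (Fin n)} {v' q s : ℝ}
    (hX : HasDerivAt X X' s) (hY : HasDerivAt Y Y' s) (hv : HasDerivAt v v' s)
    (hX' : X' = a + v' • X s + q • Y s) (hY' : Y' = b - q • X s + v' • Y s) (i j : Fin n) :
    HasDerivAt (fun r => Real.exp (-(2 * v r)) * (X r i * X r j + Y r i * Y r j))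
      (Real.exp (-(2 * v s)) * (a i * X s j + X s i * a j + b i * Y s j + Y s i * b j)) s := by
  have cX (k : Fin n) : HasDerivAt (fun r => X r k) (X' k) s :=
    ((EuclideanSpace.proj k : _ →L[ℝ] ℝ).hasFDerivAt.comp_hasDerivAt s hX)
  have cY (k : Fin n) : HasDerivAt (fun r => Y r k) (Y' k) s :=
    ((EuclideanSpace.proj k : _ →L[ℝ] ℝ).hasFDerivAt.comp_hasDerivAt s hY)
  have h := ((hv.const_mul 2).neg.exp).mul (((cX i).mul (cX j)).add ((cY i).mul (cY j)))
  refine h.congr_deriv ?_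
  simp only [hX', hY', PiLp.add_apply, PiLp.sub_apply, PiLp.smul_apply, smul_eq_mul, Pi.neg_apply,
    Pi.add_apply, Pi.mul_apply]
  ring

theorem sum_sum_mul_eq_inner_mul_inner (p q r s : EuclideanSpace ℝ (Fin n)) :
    ∑ i, ∑ j, (p i * q j) * (r i * s j) = ⟪p, r⟫_ℝ * ⟪q, s⟫_ℝ := by
  simp only [PiLp.inner_apply, RCLike.inner_apply, conj_trivial, Finset.sum_mul_sum]
  exact Finset.sum_congr rfl fun i _ => Finset.sum_congr rfl fun j _ => by ring

/-- Squared Frobenius norm of `c (a ⊙ X + b ⊙ Y)` for normal vectors `a, b`. -/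
theorem sum_sum_sq_symm_product {a b X Y : EuclideanSpace ℝ (Fin n)} {M : ℝ} (c : ℝ)
    (hXX : ‖X‖ ^ 2 = M) (hYY : ‖Y‖ ^ 2 = M) (hXY : ⟪X, Y⟫_ℝ = 0)
    (haX : ⟪X, a⟫_ℝ = 0) (haY : ⟪Y, a⟫_ℝ = 0) (hbX : ⟪X, b⟫_ℝ = 0) (hbY : ⟪Y, b⟫_ℝ = 0) :
    ∑ i, ∑ j, (c * (a i * X j + X i * a j + b i * Y j + Y i * b j)) ^ 2
      = 2 * c ^ 2 * M * (‖a‖ ^ 2 + ‖b‖ ^ 2) := by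
  have expand (i j : Fin n) : (c * (a i * X j + X i * a j + b i * Y j + Y i * b j)) ^ 2
      = c ^ 2 * ((a i * X j) * (a i * X j) + (X i * a j) * (X i * a j)
        + (b i * Y j) * (b i * Y j) + (Y i * b j) * (Y i * b j)
        + 2 * ((X i * a j) * (a i * X j)) + 2 * ((a i * X j) * (b i * Y j))
        + 2 * ((Y i * b j) * (a i * X j)) + 2 * ((X i * a j) * (b i * Y j))
        + 2 * ((X i * a j) * (Y i * b j)) + 2 * ((Y i * b j) * (b i * Y j))) := by ring
  simp only [expand, ← Finset.mul_sum, Finset.sum_add_distrib, sum_sum_mul_eq_inner_mul_inner,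
    hXY, haX, haY, hbX, hbY, real_inner_self_eq_norm_sq, hXX, hYY]
  ring

end ConformalFrames

namespace ConfImm

variable {f : ℝ → ℝ → EuclideanSpace ℝ (Fin n)} {u : ℝ → ℝ → ℝ} {S : Set ℝ} {t : ℝ}

/-- The components of the second fundamental form are normal. -/
theorem inner_secondFundamentalForm_eq_zero (h : ConfImm f u S) (hS : IsOpen S) (ht : t ∈ S)
    (θ : ℝ) :
    (⟪pt f t θ, Att f u t θ⟫_ℝ = 0 ∧ ⟪pth f t θ, Att f u t θ⟫_ℝ = 0) ∧
    (⟪pt f t θ, Atth f u t θ⟫_ℝ = 0 ∧ ⟪pth f t θ, Atth f u t θ⟫_ℝ = 0) ∧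
    (⟪pt f t θ, Athth f u t θ⟫_ℝ = 0 ∧ ⟪pth f t θ, Athth f u t θ⟫_ℝ = 0) := by
  have near : ∀ᶠ r in nhds t, r ∈ S := hS.mem_nhds ht
  have dX := contDiff_pt h.smooth_f
  have dY := contDiff_pth h.smooth_f
  have XXt := inner_deriv_self_of_norm_sq_eq_exp (hasDerivAt_pt dX t θ)
    (hasDerivAt_pt h.smooth_u t θ) (near.mono fun r hr => h.conf_t r hr θ)
  have YYt := inner_deriv_self_of_norm_sq_eq_exp (hasDerivAt_pt dY t θ)
    (hasDerivAt_pt h.smooth_u t θ) (near.mono fun r hr => h.conf_th r hr θ)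
  have XYt := inner_deriv_add_inner_deriv_of_orthogonal (hasDerivAt_pt dX t θ)
    (hasDerivAt_pt dY t θ) (near.mono fun r hr => h.conf_orth r hr θ)
  have XXth := inner_deriv_self_of_norm_sq_eq_exp (hasDerivAt_pth dX t θ)
    (hasDerivAt_pth h.smooth_u t θ) (.of_forall fun r => h.conf_t t ht r)
  have YYth := inner_deriv_self_of_norm_sq_eq_exp (hasDerivAt_pth dY t θ)
    (hasDerivAt_pth h.smooth_u t θ) (.of_forall fun r => h.conf_th t ht r)
  have XYth := inner_deriv_add_inner_deriv_of_orthogonal (hasDerivAt_pth dX t θ)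
    (hasDerivAt_pth dY t θ) (.of_forall fun r => h.conf_orth t ht r)
  rw [pth_pt_eq_pt_pth h.smooth_f] at XXth XYth
  have XX := h.conf_t t ht θ
  have YY := h.conf_th t ht θ
  have XY := h.conf_orth t ht θ
  have YX : ⟪pth f t θ, pt f t θ⟫_ℝ = 0 := by rw [real_inner_comm, XY]
  simp only [Att, Atth, Athth, inner_add_right, inner_sub_right, inner_smul_right,
    real_inner_self_eq_norm_sq, XX, YY, XY, YX]
  refine ⟨⟨?_, ?_⟩, ⟨?_, ?_⟩, ?_, ?_⟩ <;> linarith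

theorem sum_sum_sq_deriv_Pproj_fst (h : ConfImm f u S) (hS : IsOpen S) (ht : t ∈ S) (θ : ℝ) :
    ∑ i, ∑ j, (deriv (fun s => Pproj f u s θ i j) t) ^ 2
      = 2 * Real.exp (-(2 * u t θ)) ^ 2 * Real.exp (2 * u t θ)
        * (‖Att f u t θ‖ ^ 2 + ‖Atth f u t θ‖ ^ 2) := by
  have key := fun i j => (hasDerivAt_frame_projection (a := Att f u t θ) (b := Atth f u t θ)
    (q := -pth u t θ) (hasDerivAt_pt (contDiff_pt h.smooth_f) t θ)
    (hasDerivAt_pt (contDiff_pth h.smooth_f) t θ) (hasDerivAt_pt h.smooth_u t θ)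
    (by simp only [Att]; module) (by simp only [Atth]; module) i j).deriv
  obtain ⟨⟨h1, h2⟩, ⟨h3, h4⟩, -⟩ := h.inner_secondFundamentalForm_eq_zero hS ht θ
  simp only [Pproj, key]
  exact sum_sum_sq_symm_product _ (h.conf_t t ht θ) (h.conf_th t ht θ) (h.conf_orth t ht θ)
    h1 h2 h3 h4

theorem sum_sum_sq_deriv_Pproj_snd (h : ConfImm f u S) (hS : IsOpen S) (ht : t ∈ S) (θ : ℝ) :
    ∑ i, ∑ j, (deriv (fun s => Pproj f u t s i j) θ) ^ 2
      = 2 * Real.exp (-(2 * u t θ)) ^ 2 * Real.exp (2 * u t θ)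
        * (‖Atth f u t θ‖ ^ 2 + ‖Athth f u t θ‖ ^ 2) := by
  have key := fun i j => (hasDerivAt_frame_projection (a := Atth f u t θ) (b := Athth f u t θ)
    (q := pt u t θ) (hasDerivAt_pth (contDiff_pt h.smooth_f) t θ)
    (hasDerivAt_pth (contDiff_pth h.smooth_f) t θ) (hasDerivAt_pth h.smooth_u t θ)
    (by simp only [Atth, pth_pt_eq_pt_pth h.smooth_f]; module)
    (by simp only [Athth]; module) i j).deriv
  obtain ⟨-, ⟨h1, h2⟩, h3, h4⟩ := h.inner_secondFundamentalForm_eq_zero hS ht θ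
  simp only [Pproj, key]
  exact sum_sum_sq_symm_product _ (h.conf_t t ht θ) (h.conf_th t ht θ) (h.conf_orth t ht θ)
    h1 h2 h3 h4

end ConfImm

theorem Att_add_Athth (f : ℝ → ℝ → EuclideanSpace ℝ (Fin n)) (u : ℝ → ℝ → ℝ) (t θ : ℝ) :
    Att f u t θ + Athth f u t θ = Real.exp (2 * u t θ) • Hmc f u t θ := by
  rw [Hmc, smul_smul, ← Real.exp_add, add_neg_cancel, Real.exp_zero, Att, Athth]
  module

theorem norm_Att_sub_Athth_le (f : ℝ → ℝ → EuclideanSpace ℝ (Fin n)) (u : ℝ → ℝ → ℝ) (t θ : ℝ) :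
    ‖Att f u t θ - Athth f u t θ‖ ≤ 2 * Real.exp (2 * u t θ) * Real.sqrt (Asq f u t θ) := by
  have hsq : Real.exp (2 * u t θ) ^ 2 * Asq f u t θ
      = ‖Att f u t θ‖ ^ 2 + 2 * ‖Atth f u t θ‖ ^ 2 + ‖Athth f u t θ‖ ^ 2 := by
    rw [Asq, ← mul_assoc, ← Real.exp_nat_mul, ← Real.exp_add]
    ring_nf
    simp
  have hA : 0 ≤ Asq f u t θ := by unfold Asq; positivity
  refine (norm_sub_le _ _).trans (abs_le_of_sq_le_sq' ?_ (by positivity)).2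
  rw [mul_pow, mul_pow, Real.sq_sqrt hA, mul_assoc, hsq]
  nlinarith [sq_nonneg (‖Att f u t θ‖ - ‖Athth f u t θ‖), sq_nonneg ‖Atth f u t θ‖,
    sq_nonneg ‖Att f u t θ‖, sq_nonneg ‖Athth f u t θ‖]

/-- **Lemma 4.1** (pointwise Pohozaev-type inequality for the Gauss map,
expressed through the projection field `P`). -/
theorem pohozaev_gauss_map :
    ∃ C > (0 : ℝ), ∀ (n : ℕ) (f : ℝ → ℝ → EuclideanSpace ℝ (Fin n)) (u : ℝ → ℝ → ℝ)
      (t₁ t₂ : ℝ), ConfImm f u (Set.Ioo t₁ t₂) →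
      ∀ t ∈ Set.Ioo t₁ t₂, ∀ θ : ℝ,
        |(∑ i : Fin n, ∑ j : Fin n, (deriv (fun s => Pproj f u s θ i j) t) ^ 2)
          - ∑ i : Fin n, ∑ j : Fin n, (deriv (fun s => Pproj f u t s i j) θ) ^ 2|
        ≤ C * Real.exp (2 * u t θ) * Real.sqrt (Asq f u t θ) * ‖Hmc f u t θ‖ := by
  refine ⟨4, by norm_num, fun n f u t₁ t₂ h t ht θ => ?_⟩
  rw [h.sum_sum_sq_deriv_Pproj_fst isOpen_Ioo ht, h.sum_sum_sq_deriv_Pproj_snd isOpen_Ioo ht]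
  have hexp : Real.exp (-(2 * u t θ)) * Real.exp (2 * u t θ) = 1 := by
    rw [← Real.exp_add, neg_add_cancel, Real.exp_zero]
  have hdiff : ‖Att f u t θ‖ ^ 2 - ‖Athth f u t θ‖ ^ 2
      = Real.exp (2 * u t θ) * ⟪Hmc f u t θ, Att f u t θ - Athth f u t θ⟫_ℝ := by
    rw [← real_inner_smul_left, ← Att_add_Athth, inner_add_left, inner_sub_right, inner_sub_right,
      real_inner_self_eq_norm_sq, real_inner_self_eq_norm_sq,
      real_inner_comm (Att f u t θ) (Athth f u t θ)]
    ring
  have hlhs : 2 * Real.exp (-(2 * u t θ)) ^ 2 * Real.exp (2 * u t θ)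
        * (‖Att f u t θ‖ ^ 2 + ‖Atth f u t θ‖ ^ 2)
      - 2 * Real.exp (-(2 * u t θ)) ^ 2 * Real.exp (2 * u t θ)
        * (‖Atth f u t θ‖ ^ 2 + ‖Athth f u t θ‖ ^ 2)
      = 2 * ⟪Hmc f u t θ, Att f u t θ - Athth f u t θ⟫_ℝ := by
    calc _ = 2 * Real.exp (-(2 * u t θ)) * (Real.exp (-(2 * u t θ)) * Real.exp (2 * u t θ))
          * (‖Att f u t θ‖ ^ 2 - ‖Athth f u t θ‖ ^ 2) := by ring
      _ = 2 * (Real.exp (-(2 * u t θ)) * Real.exp (2 * u t θ))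
          * (Real.exp (-(2 * u t θ)) * Real.exp (2 * u t θ))
          * ⟪Hmc f u t θ, Att f u t θ - Athth f u t θ⟫_ℝ := by rw [hdiff]; ring
      _ = _ := by rw [hexp, mul_one, mul_one]
  rw [hlhs, abs_mul, abs_two]
  calc 2 * |⟪Hmc f u t θ, Att f u t θ - Athth f u t θ⟫_ℝ|
      ≤ 2 * (‖Hmc f u t θ‖ * ‖Att f u t θ - Athth f u t θ‖) := by
        gcongr
        exact abs_real_inner_le_norm _ _
    _ ≤ 2 * (‖Hmc f u t θ‖ * (2 * Real.exp (2 * u t θ) * Real.sqrt (Asq f u t θ))) := by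
        gcongr
        exact norm_Att_sub_Athth_le f u t θ
    _ = _ := by ring
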